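/- arXiv:math/0104258 — 6 statements merged into one kernel-verified Lean document; each statement's English description precedes it below -/
import Mathlib

section
/- Let π be a non-degenerate representation of a C*-algebra A on a Hilbert space H, E a finite-rank orthogonal projection on H, F a finite subset of A, and ε > 0. Then there is a finite-rank self-adjoint operator K on H such that E ≤ K ≤ 1 and ‖[π(x), K]‖ < ε for all x ∈ F. -/
section AlmostCommuting

open scoped ComplexOrder

variable {𝕜 H : Type*} [RCLike 𝕜] [NormedAddCommGroup H] [InnerProductSpace 𝕜 H]

/-- A finite-dimensional subspace starts an increasing sequence of finite-dimensional subspaces,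
each of which is mapped into the next one by finitely many given operators. -/
theorem exists_monotone_finiteDimensional_mapsTo_succ (V₀ : Submodule 𝕜 H)
    [FiniteDimensional 𝕜 V₀] (S : Finset (H →L[𝕜] H)) :
    ∃ V : ℕ → Submodule 𝕜 H, V 0 = V₀ ∧ Monotone V ∧ (∀ n, FiniteDimensional 𝕜 (V n)) ∧
      ∀ T ∈ S, ∀ n, ∀ v ∈ V n, T v ∈ V (n + 1) := by
  obtain ⟨V, rfl, hV⟩ : ∃ V : ℕ → Submodule 𝕜 H, V 0 = V₀ ∧
      ∀ n, V (n + 1) = V n ⊔ S.sup fun T ↦ (V n).map (T : H →ₗ[𝕜] H) :=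
    ⟨fun n ↦ Nat.rec V₀ (fun _ W ↦ W ⊔ S.sup fun T ↦ W.map (T : H →ₗ[𝕜] H)) n,
      rfl, fun _ ↦ rfl⟩
  have hfin (n : ℕ) : FiniteDimensional 𝕜 (V n) := by
    induction n with
    | zero => assumption
    | succ n ih =>
      rw [hV]
      infer_instance
  refine ⟨V, rfl, monotone_nat_of_le_succ fun n ↦ hV n ▸ le_sup_left, hfin,
    fun T hT n v hv ↦ ?_⟩
  · rw [hV]
    refine Submodule.mem_sup_right ?_
    exact Finset.le_sup (f := fun T : H →L[𝕜] H ↦ (V n).map (T : H →ₗ[𝕜] H)) hT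
      (Submodule.mem_map_of_mem hv)

variable {V : ℕ → Submodule 𝕜 H} [∀ n, (V n).HasOrthogonalProjection] {T : H →L[𝕜] H}

theorem norm_sum_one_sub_starProjection_mul_le (hV : Monotone V)
    (hT : ∀ n, ∀ v ∈ V n, T v ∈ V (n + 1)) (n : ℕ) :
    ‖∑ k ∈ Finset.range n, (1 - (V k).starProjection) * T * (V k).starProjection‖ ≤
      √n * ‖T‖ := by
  refine ContinuousLinearMap.opNorm_le_bound _ (by positivity) fun x ↦ ?_
  let v : ℕ → H := fun k ↦ ((1 - (V k).starProjection) * T * (V k).starProjection) x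
  have hv_eq (k : ℕ) : v k = T ((V k).starProjection x) -
      (V k).starProjection (T ((V k).starProjection x)) := rfl
  have hv_mem (k : ℕ) : v k ∈ V (k + 1) := by
    rw [hv_eq]
    exact sub_mem (hT k _ (Submodule.starProjection_apply_mem _ _))
      (hV k.le_succ (Submodule.starProjection_apply_mem _ _))
  have hv_orth (k : ℕ) : v k ∈ (V k)ᗮ := Submodule.sub_starProjection_mem_orthogonal _
  have hv_norm (k : ℕ) : ‖v k‖ ≤ ‖T‖ * ‖x‖ := by
    have h₁ : ‖v k‖ ≤ ‖T ((V k).starProjection x)‖ := by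
      have := (V k).norm_sq_eq_add_norm_sq_starProjection (T ((V k).starProjection x))
      rw [Submodule.starProjection_orthogonal_val, ← hv_eq] at this
      exact le_of_sq_le_sq (by
        nlinarith [sq_nonneg ‖(V k).starProjection (T ((V k).starProjection x))‖]) (norm_nonneg _)
    refine h₁.trans (T.le_opNorm_of_le ?_)
    exact (V k).norm_starProjection_apply_le x
  have key : (∑ k ∈ Finset.range n, v k) ∈ V n ∧
      ‖∑ k ∈ Finset.range n, v k‖ ^ 2 ≤ n * (‖T‖ * ‖x‖) ^ 2 := by
    induction n with
    | zero => simp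
    | succ n ih =>
      rw [Finset.sum_range_succ]
      refine ⟨add_mem (hV n.le_succ ih.1) (hv_mem n), ?_⟩
      have h := norm_add_sq_eq_norm_sq_add_norm_sq_of_inner_eq_zero _ _
        ((V n).mem_orthogonal _ |>.mp (hv_orth n) _ ih.1)
      have := pow_le_pow_left₀ (norm_nonneg _) (hv_norm n) 2
      push_cast
      nlinarith [ih.2]
  rw [sum_apply]
  refine (Real.le_sqrt_of_sq_le key.2).trans_eq ?_
  rw [Real.sqrt_mul n.cast_nonneg, Real.sqrt_sq (by positivity), mul_assoc]

theorem norm_commutator_sum_starProjection_le [CompleteSpace H] (hV : Monotone V)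
    (hT : ∀ n, ∀ v ∈ V n, T v ∈ V (n + 1)) (hT' : ∀ n, ∀ v ∈ V n, star T v ∈ V (n + 1)) (n : ℕ) :
    ‖T * (∑ k ∈ Finset.range n, (V k).starProjection) -
      (∑ k ∈ Finset.range n, (V k).starProjection) * T‖ ≤ 2 * (√n * ‖T‖) := by
  have h : T * (∑ k ∈ Finset.range n, (V k).starProjection) -
      (∑ k ∈ Finset.range n, (V k).starProjection) * T =
      (∑ k ∈ Finset.range n, (1 - (V k).starProjection) * T * (V k).starProjection) -
      star (∑ k ∈ Finset.range n, (1 - (V k).starProjection) * star T * (V k).starProjection) := by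
    rw [star_sum, Finset.mul_sum, Finset.sum_mul, ← Finset.sum_sub_distrib,
      ← Finset.sum_sub_distrib]
    refine Finset.sum_congr rfl fun k _ ↦ ?_
    simp only [star_mul, star_sub, star_one, star_star,
      (isSelfAdjoint_starProjection (V k)).star_eq]
    noncomm_ring
  rw [h, two_mul]
  refine (norm_sub_le _ _).trans (add_le_add ?_ ?_)
  · exact norm_sum_one_sub_starProjection_mul_le hV hT n
  · rw [ContinuousLinearMap.star_eq_adjoint, LinearIsometryEquiv.norm_map,
      ← LinearIsometryEquiv.norm_map ContinuousLinearMap.adjoint T]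
    exact norm_sum_one_sub_starProjection_mul_le hV hT' n

/-- Finitely many bounded operators almost commute with some finite-rank positive contraction
dominating a given finite-dimensional orthogonal projection. -/
theorem exists_finiteDimensional_range_norm_commutator_lt [CompleteSpace H] (V₀ : Submodule 𝕜 H)
    [FiniteDimensional 𝕜 V₀] (S : Finset (H →L[𝕜] H)) {ε : ℝ} (hε : 0 < ε) :
    ∃ K : H →L[𝕜] H, IsSelfAdjoint K ∧
      FiniteDimensional 𝕜 (LinearMap.range (K : H →ₗ[𝕜] H)) ∧
      (K - V₀.starProjection).IsPositive ∧ (1 - K).IsPositive ∧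
      ∀ T ∈ S, ‖T * K - K * T‖ < ε := by
  classical
  obtain ⟨V, rfl, hV, hfin, hmap⟩ :=
    exists_monotone_finiteDimensional_mapsTo_succ V₀ (S ∪ S.image star)
  obtain ⟨n, hn⟩ := exists_nat_gt ((2 * (∑ T ∈ S, ‖T‖) / ε) ^ 2)
  have hn₀ : (0 : ℝ) < n := (sq_nonneg _).trans_lt hn
  have hn₁ : (n : 𝕜) ≠ 0 := by exact_mod_cast hn₀.ne'
  have hc : (0 : 𝕜) ≤ (n : 𝕜)⁻¹ := by
    rw [← RCLike.ofReal_natCast, ← RCLike.ofReal_inv]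
    exact RCLike.ofReal_nonneg.mpr (by positivity)
  have hconst (A : H →L[𝕜] H) : A = (n : 𝕜)⁻¹ • ∑ _k ∈ Finset.range n, A := by
    rw [Finset.sum_const, Finset.card_range, ← Nat.cast_smul_eq_nsmul 𝕜, inv_smul_smul₀ hn₁]
  let K : H →L[𝕜] H := (n : 𝕜)⁻¹ • ∑ k ∈ Finset.range n, (V k).starProjection
  have hK₁ : (1 - K).IsPositive := by
    rw [hconst 1, ← smul_sub, ← Finset.sum_sub_distrib]
    refine (ContinuousLinearMap.isPositive_sum _ fun k _ ↦ ?_).smul_of_nonneg hc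
    exact .of_isStarProjection isStarProjection_starProjection.one_sub
  refine ⟨K, ?_, ?_, ?_, hK₁, fun T hT ↦ ?_⟩
  · simpa using (IsSelfAdjoint.one (H →L[𝕜] H)).sub hK₁.isSelfAdjoint
  · refine Submodule.finiteDimensional_of_le (S₂ := V n) ?_
    rintro _ ⟨x, rfl⟩
    simp only [K, ContinuousLinearMap.coe_coe, smul_apply,
      sum_apply]
    refine Submodule.smul_mem _ _ (Submodule.sum_mem _ fun k hk ↦ ?_)
    exact hV (Finset.mem_range.mp hk).le (Submodule.starProjection_apply_mem _ _)
  · rw [hconst (V 0).starProjection, ← smul_sub, ← Finset.sum_sub_distrib]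
    refine (ContinuousLinearMap.isPositive_sum _ fun k _ ↦ ?_).smul_of_nonneg hc
    exact Submodule.starProjection_le_starProjection_iff.mpr (hV k.zero_le)
  · have hT₁ := hmap T (Finset.mem_union_left _ hT)
    have hT₂ := hmap (star T) (Finset.mem_union_right _ (Finset.mem_image_of_mem _ hT))
    have hle := norm_commutator_sum_starProjection_le hV hT₁ hT₂ n
    have hsum : ‖T‖ ≤ ∑ T ∈ S, ‖T‖ :=
      Finset.single_le_sum (f := fun T : H →L[𝕜] H ↦ ‖T‖) (fun _ _ ↦ norm_nonneg _) hT
    have hsqrt : 2 * ‖T‖ < ε * √n := by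
      have := Real.lt_sqrt_of_sq_lt hn
      rw [div_lt_iff₀ hε] at this
      linarith
    rw [mul_smul_comm, smul_mul_assoc, ← smul_sub, norm_smul, norm_inv, RCLike.norm_natCast,
      inv_mul_lt_iff₀ hn₀]
    refine hle.trans_lt ?_
    have hs : 0 < √(n : ℝ) := Real.sqrt_pos.mpr hn₀
    nlinarith [Real.mul_self_sqrt hn₀.le]

end AlmostCommuting

/-- **Lemma 3.2 (Lemma A2).**  Let `π` be a non-degenerate representation of a
C⋆-algebra `A` on a Hilbert space `H`, `E` a finite-rank orthogonal projection on `H`,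
`F` a finite subset of `A`, and `ε > 0`.  Then there is a finite-rank self-adjoint
operator `K` on `H` with `E ≤ K ≤ 1` and `‖[π(x), K]‖ < ε` for all `x ∈ F`. -/
theorem finite_rank_almost_commuting {A : Type*} [NonUnitalCStarAlgebra A]
    {H : Type*} [NormedAddCommGroup H] [InnerProductSpace ℂ H] [CompleteSpace H]
    (π : A →⋆ₙₐ[ℂ] (H →L[ℂ] H))
    (hπ : Dense ((Submodule.span ℂ {y : H | ∃ (a : A) (ξ : H), y = π a ξ} :
      Submodule ℂ H) : Set H))
    (E : H →L[ℂ] H) (hE₁ : IsIdempotentElem E) (hE₂ : IsSelfAdjoint E)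
    (hE₃ : FiniteDimensional ℂ (LinearMap.range (E : H →ₗ[ℂ] H)))
    (F : Finset A) (ε : ℝ) (hε : 0 < ε) :
    ∃ K : H →L[ℂ] H, IsSelfAdjoint K ∧
      FiniteDimensional ℂ (LinearMap.range (K : H →ₗ[ℂ] H)) ∧
      (K - E).IsPositive ∧ (1 - K).IsPositive ∧
      ∀ x ∈ F, ‖π x * K - K * π x‖ < ε := by
  classical
  obtain ⟨_, hE⟩ :=
    isStarProjection_iff_eq_starProjection_range.mp ⟨hE₁, hE₂⟩
  obtain ⟨K, hK, hfin, hEK, hK₁, hlt⟩ := exists_finiteDimensional_range_norm_commutator_lt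
    (LinearMap.range (E : H →ₗ[ℂ] H)) (F.image π) hε
  refine ⟨K, hK, hfin, ?_, hK₁, fun x hx ↦ hlt _ (Finset.mem_image_of_mem _ hx)⟩
  rw [hE]
  exact hEK
end

section
/- Let (X,d) be a compact metric space and ε > 0. If S₁ and S₂ are ε-nets of X each consisting of exactly N(X,ε) points, then there is a bijection f of S₁ onto S₂ such that d(x, f(x)) < 2ε for all x ∈ S₁. -/
/-- A subset `S` of a metric space is an `ε`-net if the open balls of radius `ε`
centered at points of `S` cover the space. -/
def IsENet {X : Type*} [MetricSpace X] (S : Set X) (ε : ℝ) : Prop :=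
  ∀ y : X, ∃ x ∈ S, dist y x < ε

/-- `netNumber X ε` is `N(X, ε)`, the minimal cardinality of a finite `ε`-net of `X`
(defined as the infimum of the cardinalities of finite `ε`-nets). -/
noncomputable def netNumber (X : Type*) [MetricSpace X] (ε : ℝ) : ℕ :=
  sInf {n : ℕ | ∃ S : Finset X, S.card = n ∧ IsENet (↑S : Set X) ε}

theorem netNumber_le_card {X : Type*} [MetricSpace X] {ε : ℝ} {S : Finset X}
    (hS : IsENet (↑S : Set X) ε) : netNumber X ε ≤ S.card :=
  Nat.sInf_le ⟨S, rfl, hS⟩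

open Classical in
/-- Replacing a part `A` of an `ε`-net by all points of a second `ε`-net at distance less
than `2 * ε` from `A` yields an `ε`-net. -/
theorem IsENet.sdiff_union_biUnion_filter {X : Type*} [MetricSpace X] {ε : ℝ}
    {S T : Finset X} (hS : IsENet (↑S : Set X) ε) (hT : IsENet (↑T : Set X) ε)
    (A : Finset X) :
    IsENet (↑(S \ A ∪ A.biUnion fun x => T.filter fun y => dist x y < 2 * ε) : Set X) ε := by
  intro z
  obtain ⟨x, hx, hzx⟩ := hS z
  by_cases hxA : x ∈ A
  · obtain ⟨y, hy, hzy⟩ := hT z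
    have hxy : dist x y < 2 * ε := by
      linarith [dist_triangle_left x y z]
    refine ⟨y, ?_, hzy⟩
    simp only [Finset.mem_coe, Finset.mem_union, Finset.mem_biUnion, Finset.mem_filter]
    exact Or.inr ⟨x, hxA, hy, hxy⟩
  · refine ⟨x, ?_, hzx⟩
    simp only [Finset.mem_coe, Finset.mem_union, Finset.mem_sdiff]
    exact Or.inl ⟨hx, hxA⟩

open Classical in
/-- Hall's condition for the relation `dist x y < 2 * ε` between a minimal `ε`-net `S` and
an arbitrary `ε`-net `T`. -/
theorem IsENet.card_le_card_biUnion_filter {X : Type*} [MetricSpace X] {ε : ℝ}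
    {S T A : Finset X} (hS : IsENet (↑S : Set X) ε) (hT : IsENet (↑T : Set X) ε)
    (hc : S.card = netNumber X ε) (hA : A ⊆ S) :
    A.card ≤ (A.biUnion fun x => T.filter fun y => dist x y < 2 * ε).card := by
  have h := (netNumber_le_card (hS.sdiff_union_biUnion_filter hT A)).trans
    (Finset.card_union_le _ _)
  have := Finset.card_sdiff_add_card_eq_card hA
  lia

/-- **Lemma 3.6 (Lemma A6).**  Let `(X, d)` be a compact metric space and `ε > 0`.  If
`S₁` and `S₂` are `ε`-nets of `X`, each consisting of exactly `N(X, ε)` points, then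
there is a bijection `f` of `S₁` onto `S₂` with `d(x, f(x)) < 2ε` for all `x ∈ S₁`. -/
theorem nets_matching {X : Type*} [MetricSpace X] [CompactSpace X]
    (ε : ℝ) (hε : 0 < ε) (S₁ S₂ : Finset X)
    (h₁ : IsENet (↑S₁ : Set X) ε) (h₂ : IsENet (↑S₂ : Set X) ε)
    (hc₁ : S₁.card = netNumber X ε) (hc₂ : S₂.card = netNumber X ε) :
    ∃ f : X → X, Set.BijOn f (↑S₁ : Set X) (↑S₂ : Set X) ∧
      ∀ x ∈ S₁, dist x (f x) < 2 * ε := by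
  classical
  obtain ⟨g, hg, hgt⟩ := (Finset.all_card_le_biUnion_card_iff_exists_injective
    fun x : S₁ => S₂.filter fun y => dist (x : X) y < 2 * ε).1 fun s => by
      have hA : s.image Subtype.val ⊆ S₁ := by
        intro x hx
        obtain ⟨a, -, rfl⟩ := Finset.mem_image.1 hx
        exact a.2
      simpa only [Finset.image_biUnion, Finset.card_image_of_injective _
        Subtype.val_injective] using h₁.card_le_card_biUnion_filter h₂ hc₁ hA
  simp only [Finset.mem_filter] at hgt
  let f : X → X := fun x => if hx : x ∈ S₁ then g ⟨x, hx⟩ else x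
  have hf : ∀ x (hx : x ∈ S₁), f x = g ⟨x, hx⟩ := fun x hx => dif_pos hx
  have hmaps : Set.MapsTo f (↑S₁ : Set X) (↑S₂ : Set X) := fun x hx => by
    rw [hf x hx]
    exact (hgt ⟨x, hx⟩).1
  have hinj : Set.InjOn f (↑S₁ : Set X) := fun x hx y hy hxy => by
    rw [hf x hx, hf y hy] at hxy
    exact congrArg Subtype.val (hg hxy)
  refine ⟨f, ⟨hmaps, hinj, ?_⟩, fun x hx => ?_⟩
  · exact Finset.surjOn_of_injOn_of_card_le f hmaps hinj (hc₂.trans hc₁.symm).le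
  · rw [hf x hx]
    exact (hgt ⟨x, hx⟩).2
end

section
/- Let K be a Hilbert space, P an orthogonal projection on K, B a bounded operator on K with 0 ≤ B ≤ 1, and δ ≥ 0. If PBP ≥ (1−2δ)P, then ‖PB(1−P)‖ ≤ 2√δ and ‖[P,B]‖ ≤ 2√δ. -/
section

variable {K : Type*} [NormedAddCommGroup K] [InnerProductSpace ℂ K]

/-- A positive contraction `C` satisfies `C² ≤ C`, in quadratic-form version. -/
theorem sq_norm_apply_le_re_inner_of_isPositive {C : K →L[ℂ] K} (hC₀ : C.IsPositive)
    (hC₁ : (1 - C).IsPositive) (y : K) :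
    ‖C y‖ ^ 2 ≤ (inner ℂ (C y) y).re := by
  have h₁ := hC₀.re_inner_nonneg_left (y - C y)
  have h₂ := hC₁.re_inner_nonneg_left (C y)
  have hsymm : inner ℂ (C (C y)) y = inner ℂ (C y) (C y) := hC₀.isSymmetric (C y) y
  have hnorm : (inner ℂ (C y) (C y)).re = ‖C y‖ ^ 2 := inner_self_eq_norm_sq (𝕜 := ℂ) (C y)
  simp only [map_sub, inner_sub_left, inner_sub_right, hsymm, sub_apply,
    one_apply_eq_self, RCLike.re_to_complex, hnorm] at h₁ h₂
  linarith

variable [CompleteSpace K]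

theorem sq_norm_apply_add_sq_norm_sub_apply {P : K →L[ℂ] K} (hP₁ : IsIdempotentElem P)
    (hP₂ : IsSelfAdjoint P) (x : K) : ‖P x‖ ^ 2 + ‖x - P x‖ ^ 2 = ‖x‖ ^ 2 := by
  have hidem : P (P x) = P x := DFunLike.congr_fun hP₁ x
  have horth : inner ℂ (P x) (x - P x) = 0 := by
    have hsymm : inner ℂ (P x) (x - P x) = inner ℂ x (P (x - P x)) := hP₂.isSymmetric _ _
    rw [hsymm, map_sub, hidem, sub_self, inner_zero_right]
  have := norm_add_sq_eq_norm_sq_add_norm_sq_of_inner_eq_zero (P x) (x - P x) horth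
  rw [add_sub_cancel] at this
  linarith

/-- The off-diagonal corner of `B` is bounded by `√(2δ)` when `PBP ≥ (1 - 2δ)P`. -/
theorem norm_one_sub_mul_mul_le_sqrt {P B : K →L[ℂ] K} (hP₁ : IsIdempotentElem P)
    (hP₂ : IsSelfAdjoint P) (hB₀ : B.IsPositive) (hB₁ : (1 - B).IsPositive) {δ : ℝ} (hδ : 0 ≤ δ)
    (h : (P * B * P - ((1 : ℝ) - 2 * δ) • P).IsPositive) :
    ‖(1 - P) * B * P‖ ≤ √(2 * δ) := by
  refine ContinuousLinearMap.opNorm_le_bound _ (Real.sqrt_nonneg _) fun x ↦ ?_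
  have hidem : P (P x) = P x := DFunLike.congr_fun hP₁ x
  have hcontr : ‖(1 - B) (P x)‖ ^ 2 ≤ (inner ℂ ((1 - B) (P x)) (P x)).re :=
    sq_norm_apply_le_re_inner_of_isPositive hB₁ (by simpa using hB₀) (P x)
  have hcorner := h.re_inner_nonneg_left (P x)
  have hself : (inner ℂ (P x) (P x)).re = ‖P x‖ ^ 2 := inner_self_eq_norm_sq (𝕜 := ℂ) (P x)
  have hmove : inner ℂ (P (B (P x))) (P x) = inner ℂ (B (P x)) (P x) := by
    have hsymm : inner ℂ (P (B (P x))) (P x) = inner ℂ (B (P x)) (P (P x)) := hP₂.isSymmetric _ _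
    rw [hsymm, hidem]
  simp only [sub_apply, mul_apply_eq_comp,
    smul_apply, one_apply_eq_self, hidem, inner_sub_left, hmove,
    RCLike.re_to_complex, Complex.sub_re, inner_smul_left_eq_smul, Complex.smul_re, smul_eq_mul,
    hself] at hcontr hcorner
  have hpyth_C := sq_norm_apply_add_sq_norm_sub_apply hP₁ hP₂ (P x - B (P x))
  have hpyth := sq_norm_apply_add_sq_norm_sub_apply hP₁ hP₂ x
  have heq : ‖((1 - P) * B * P) x‖ = ‖P x - B (P x) - P (P x - B (P x))‖ := by
    rw [← norm_neg]
    congr 1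
    simp only [sub_apply, mul_apply_eq_comp,
      one_apply_eq_self, map_sub, hidem]
    abel
  rw [heq]
  refine le_of_sq_le_sq ?_ (by positivity)
  rw [mul_pow, Real.sq_sqrt (by positivity)]
  nlinarith [sq_nonneg ‖P (P x - B (P x))‖, mul_nonneg hδ (sq_nonneg ‖x - P x‖)]

end

/-- If `P` is an orthogonal projection on a Hilbert space `K`, `B` is an operator with
`0 ≤ B ≤ 1`, `δ ≥ 0`, and `PBP ≥ (1 - 2δ)P`, then `‖PB(1 - P)‖ ≤ 2√δ` and
`‖[P, B]‖ ≤ 2√δ`. -/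
theorem corner_commutator_estimate {K : Type*} [NormedAddCommGroup K]
    [InnerProductSpace ℂ K] [CompleteSpace K]
    (P : K →L[ℂ] K) (hP₁ : IsIdempotentElem P) (hP₂ : IsSelfAdjoint P)
    (B : K →L[ℂ] K) (hB₀ : B.IsPositive) (hB₁ : (1 - B).IsPositive)
    (δ : ℝ) (hδ : 0 ≤ δ)
    (h : (P * B * P - ((1 : ℝ) - 2 * δ) • P).IsPositive) :
    ‖P * B * (1 - P)‖ ≤ 2 * Real.sqrt δ ∧ ‖P * B - B * P‖ ≤ 2 * Real.sqrt δ := by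
  have hlower : ‖(1 - P) * B * P‖ ≤ √(2 * δ) := norm_one_sub_mul_mul_le_sqrt hP₁ hP₂ hB₀ hB₁ hδ h
  have hstar : star ((1 - P) * B * P) = P * B * (1 - P) := by
    simp only [star_mul, star_sub, star_one, hP₂.star_eq, hB₀.isSelfAdjoint.star_eq, mul_assoc]
  have hupper : ‖P * B * (1 - P)‖ ≤ √(2 * δ) := by rwa [← hstar, norm_star]
  have hsqrt : √(2 * δ) ^ 2 = 2 * δ := Real.sq_sqrt (by positivity)
  have hsqrt' : √δ ^ 2 = δ := Real.sq_sqrt hδ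
  refine ⟨hupper.trans (le_of_sq_le_sq (by nlinarith) (by positivity)),
    ContinuousLinearMap.opNorm_le_bound _ (by positivity) fun x ↦ ?_⟩
  have hidem (y : K) : P (P y) = P y := DFunLike.congr_fun hP₁ y
  have hdecomp : (P * B - B * P) x =
      (P * B * (1 - P)) (x - P x) - ((1 - P) * B * P) (P x) := by
    simp only [sub_apply, mul_apply_eq_comp,
      one_apply_eq_self, map_sub, hidem]
    abel
  have hbound : ‖(P * B - B * P) x‖ ≤ √(2 * δ) * (‖x - P x‖ + ‖P x‖) := by
    rw [hdecomp, mul_add]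
    exact (norm_sub_le _ _).trans (add_le_add (ContinuousLinearMap.le_of_opNorm_le _ hupper _)
      (ContinuousLinearMap.le_of_opNorm_le _ hlower _))
  refine hbound.trans (le_of_sq_le_sq ?_ (by positivity))
  have hpyth := sq_norm_apply_add_sq_norm_sub_apply hP₁ hP₂ x
  rw [mul_pow, mul_pow, mul_pow, hsqrt, hsqrt', ← hpyth]
  nlinarith [mul_nonneg hδ (sq_nonneg (‖x - P x‖ - ‖P x‖))]
end

section
/- Let A be a unital C*-algebra, n ∈ ℕ, G a nonempty finite subset of M_{1n}(A) such that xx* ≤ 1 for all x ∈ G, h ∈ A with 0 ≤ h ≤ 1, u a unitary in A, ε > 0, and f a bijection of G onto G such that ‖ux − f(x)‖ < ε for all x ∈ G. Set h̄ = |G|⁻¹ Σ_{x∈G} Σ_{i=1}^n x_i h x_i*. Then ‖u h̄ u* − h̄‖ < 2ε. -/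
/-- The norm of a row `x = (x₁, …, x_n) ∈ M_{1n}(A)`, namely `‖x x*‖^{1/2}` where
`x x* = ∑ i, x i * star (x i)`. -/
noncomputable def rowNorm {A : Type*} [CStarAlgebra A] {n : ℕ} (x : Fin n → A) : ℝ :=
  Real.sqrt ‖∑ i, x i * star (x i)‖

section RowNorm

variable {A : Type*} [CStarAlgebra A] {n : ℕ}

lemma rowNorm_nonneg (x : Fin n → A) : 0 ≤ rowNorm x :=
  Real.sqrt_nonneg _

lemma rowNorm_unitary_mul {u : A} (hu : u ∈ unitary A) (x : Fin n → A) :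
    rowNorm (fun i => u * x i) = rowNorm x := by
  have hsum : ∑ i, u * x i * star (u * x i) = u * (∑ i, x i * star (x i)) * star u := by
    simp only [star_mul, Finset.mul_sum, Finset.sum_mul, mul_assoc]
  rw [rowNorm, rowNorm, hsum, CStarRing.norm_mul_mem_unitary _ (Unitary.star_mem hu),
    CStarRing.norm_mem_unitary_mul _ hu]

variable [PartialOrder A] [StarOrderedRing A]

/-- The Cauchy-Schwarz inequality for rows over a C⋆-algebra. -/
lemma norm_sum_mul_star_le (x y : Fin n → A) :
    ‖∑ i, x i * star (y i)‖ ≤ rowNorm x * rowNorm y := by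
  rw [mul_comm]
  exact CStarModule.norm_inner_le (A := A) (WithCStarModule A (Fin n → A))
    (x := (WithCStarModule.equiv A (Fin n → A)).symm y)
    (y := (WithCStarModule.equiv A (Fin n → A)).symm x)

lemma rowNorm_le_one {x : Fin n → A} (hx : ∑ i, x i * star (x i) ≤ 1) : rowNorm x ≤ 1 := by
  rw [rowNorm, Real.sqrt_le_one]
  exact (CStarAlgebra.norm_le_one_iff_of_nonneg _
    (Finset.sum_nonneg fun i _ => mul_star_self_nonneg (x i))).2 hx

lemma rowNorm_mul_right_le {h : A} (hh : ‖h‖ ≤ 1) (x : Fin n → A) :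
    rowNorm (fun i => x i * h) ≤ rowNorm x := by
  have hle : h * star h ≤ 1 := by
    refine (CStarAlgebra.norm_le_one_iff_of_nonneg _ (mul_star_self_nonneg h)).1 ?_
    rw [CStarRing.norm_self_mul_star]
    exact mul_le_one₀ hh (norm_nonneg h) hh
  refine Real.sqrt_le_sqrt (CStarAlgebra.norm_le_norm_of_nonneg_of_le
    (Finset.sum_nonneg fun i _ => mul_star_self_nonneg _) (Finset.sum_le_sum fun i _ => ?_))
  simpa [mul_assoc] using star_right_conjugate_le_conjugate hle (x i)

lemma norm_sum_mul_mul_star_le {h : A} (hh : ‖h‖ ≤ 1) (x y : Fin n → A) :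
    ‖∑ i, x i * h * star (y i)‖ ≤ rowNorm x * rowNorm y :=
  (norm_sum_mul_star_le (fun i => x i * h) y).trans
    (mul_le_mul_of_nonneg_right (rowNorm_mul_right_le hh x) (rowNorm_nonneg y))

lemma norm_sum_conj_sub_sum_conj_le {h : A} (hh : ‖h‖ ≤ 1) {x y : Fin n → A}
    (hx : rowNorm x ≤ 1) (hy : rowNorm y ≤ 1) :
    ‖∑ i, x i * h * star (x i) - ∑ i, y i * h * star (y i)‖ ≤
      2 * rowNorm (fun i => x i - y i) := by
  have hsplit : ∑ i, x i * h * star (x i) - ∑ i, y i * h * star (y i) =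
      ∑ i, (x i - y i) * h * star (x i) + ∑ i, y i * h * star (x i - y i) := by
    rw [← Finset.sum_sub_distrib, ← Finset.sum_add_distrib]
    refine Finset.sum_congr rfl fun i _ => ?_
    rw [star_sub]
    noncomm_ring
  have h₁ := norm_sum_mul_mul_star_le hh (fun i => x i - y i) x
  have h₂ := norm_sum_mul_mul_star_le hh y (fun i => x i - y i)
  have h₀ := rowNorm_nonneg (fun i => x i - y i)
  rw [hsplit]
  refine (norm_add_le _ _).trans ?_
  nlinarith

end RowNorm

/-- **The averaging estimate in the proof of Lemma A.**  Let `A` be a unital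
C⋆-algebra, `G` a nonempty finite subset of `M_{1n}(A)` with `x x* ≤ 1` for `x ∈ G`,
`h ∈ A` with `0 ≤ h ≤ 1`, `u` a unitary of `A`, `ε > 0`, and `f` a bijection of `G` onto
`G` with `‖u x - f x‖ < ε` for all `x ∈ G`.  Then, with
`h̄ = |G|⁻¹ ∑_{x ∈ G} ∑ i, x i * h * star (x i)`, one has `‖u h̄ u* - h̄‖ < 2ε`. -/
theorem averaged_element_almost_invariant {A : Type*} [CStarAlgebra A] [PartialOrder A]
    [StarOrderedRing A] {n : ℕ} (G : Finset (Fin n → A)) (hGne : G.Nonempty)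
    (hG : ∀ x ∈ G, (∑ i, x i * star (x i)) ≤ 1)
    (h : A) (hh₀ : 0 ≤ h) (hh₁ : h ≤ 1)
    (u : A) (hu : u ∈ unitary A) (ε : ℝ) (hε : 0 < ε)
    (f : (Fin n → A) → (Fin n → A)) (hf : Set.BijOn f (↑G : Set (Fin n → A)) ↑G)
    (hfe : ∀ x ∈ G, rowNorm (fun i => u * x i - f x i) < ε) :
    ‖u * ((G.card : ℂ)⁻¹ • ∑ x ∈ G, ∑ i, x i * h * star (x i)) * star u -
        (G.card : ℂ)⁻¹ • ∑ x ∈ G, ∑ i, x i * h * star (x i)‖ < 2 * ε := by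
  have hh : ‖h‖ ≤ 1 := (CStarAlgebra.norm_le_one_iff_of_nonneg h hh₀).2 hh₁
  have hcard : (0 : ℝ) < G.card := by exact_mod_cast hGne.card_pos
  have hperm : ∑ x ∈ G, ∑ i, f x i * h * star (f x i) =
      ∑ x ∈ G, ∑ i, x i * h * star (x i) :=
    Finset.sum_nbij f (fun _ hx => hf.mapsTo hx) hf.injOn hf.surjOn fun _ _ => rfl
  have hdiff : u * ((G.card : ℂ)⁻¹ • ∑ x ∈ G, ∑ i, x i * h * star (x i)) * star u -
        (G.card : ℂ)⁻¹ • ∑ x ∈ G, ∑ i, x i * h * star (x i) =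
      (G.card : ℂ)⁻¹ • ∑ x ∈ G, (∑ i, u * x i * h * star (u * x i) -
        ∑ i, f x i * h * star (f x i)) := by
    rw [Finset.sum_sub_distrib, hperm, smul_sub, mul_smul_comm, smul_mul_assoc]
    simp only [star_mul, Finset.mul_sum, Finset.sum_mul, mul_assoc]
  have hterm : ∀ x ∈ G, ‖∑ i, u * x i * h * star (u * x i) -
      ∑ i, f x i * h * star (f x i)‖ < 2 * ε := fun x hx =>
    (norm_sum_conj_sub_sum_conj_le hh
      ((rowNorm_unitary_mul hu x).trans_le (rowNorm_le_one (hG x hx)))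
      (rowNorm_le_one (hG _ (hf.mapsTo hx)))).trans_lt (by linarith [hfe x hx])
  rw [hdiff, norm_smul, norm_inv, Complex.norm_natCast, inv_mul_lt_iff₀ hcard]
  calc _ ≤ ∑ x ∈ G, ‖∑ i, u * x i * h * star (u * x i) - ∑ i, f x i * h * star (f x i)‖ :=
        norm_sum_le _ _
    _ < ∑ _x ∈ G, 2 * ε := Finset.sum_lt_sum_of_nonempty hGne hterm
    _ = G.card * (2 * ε) := by rw [Finset.sum_const, nsmul_eq_mul]
end

section
/- Let (X,d) be a compact metric space, ε > 0, and let S₁ and S₂ be finite ε-nets of X each of cardinality N(X,ε). Then for every nonempty subset F ⊆ S₁, the set G = {y ∈ S₂ : B(y,ε) ∩ ⋃_{x∈F} B(x,ε) ≠ ∅} has cardinality at least that of F. -/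
/-- **The Hall-condition counting step in Lemma 3.6.**  If `S₁` and `S₂` are `ε`-nets of
a compact metric space `X`, each of minimal cardinality `N(X, ε)`, then for every
nonempty `F ⊆ S₁` the set `G` of points of `S₂` whose `ε`-ball meets some `ε`-ball
centered in `F` has cardinality at least that of `F`. -/
theorem nets_hall_condition {X : Type*} [MetricSpace X] [CompactSpace X]
    (ε : ℝ) (hε : 0 < ε) (S₁ S₂ : Finset X)
    (h₁ : IsENet (↑S₁ : Set X) ε) (h₂ : IsENet (↑S₂ : Set X) ε)
    (hc₁ : S₁.card = netNumber X ε) (hc₂ : S₂.card = netNumber X ε)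
    (F : Finset X) (hFS : F ⊆ S₁) (hFne : F.Nonempty) :
    F.card ≤ {y : X | y ∈ S₂ ∧ ∃ x ∈ F, ∃ z : X, dist z y < ε ∧ dist z x < ε}.ncard := by
  classical
  have hGfin : {y : X | y ∈ S₂ ∧ ∃ x ∈ F, ∃ z : X, dist z y < ε ∧ dist z x < ε}.Finite :=
    S₂.finite_toSet.subset fun y hy => hy.1
  rw [Set.ncard_eq_toFinset_card _ hGfin]
  have hnet : IsENet (↑((S₁ \ F) ∪ hGfin.toFinset) : Set X) ε := by
    intro z
    obtain ⟨x, hx, hzx⟩ := h₁ z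
    by_cases hxF : x ∈ F
    · obtain ⟨y, hy, hzy⟩ := h₂ z
      refine ⟨y, Finset.mem_union_right _ ?_, hzy⟩
      exact hGfin.mem_toFinset.2 ⟨hy, x, hxF, z, hzy, hzx⟩
    · exact ⟨x, Finset.mem_union_left _ (Finset.mem_sdiff.2 ⟨hx, hxF⟩), hzx⟩
  have hmin : netNumber X ε ≤ ((S₁ \ F) ∪ hGfin.toFinset).card :=
    Nat.sInf_le ⟨_, rfl, hnet⟩
  have hunion := Finset.card_union_le (S₁ \ F) hGfin.toFinset
  have hsdiff := Finset.card_sdiff_add_card_eq_card hFS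
  omega
end

section
/- The Stone–Čech compactification βℕ of the discrete space of natural numbers has cardinality 2^𝔠, where 𝔠 = 2^{ℵ₀} is the cardinality of the continuum. -/
open Set Cardinal

/-- A continuous map from a compact space to a Hausdorff space with dense range is surjective. -/
theorem Continuous.surjective_of_denseRange {X Y : Type*} [TopologicalSpace X]
    [TopologicalSpace Y] [CompactSpace X] [T2Space Y] {f : X → Y} (hf : Continuous f)
    (hd : DenseRange f) : Function.Surjective f := by
  rw [← range_eq_univ, ← (isCompact_range hf).isClosed.closure_eq, hd.closure_range]

/-- The ultrafilter limit map onto the Stone–Čech compactification of a discrete space is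
surjective. -/
theorem surjective_ultrafilter_extend_stoneCechUnit (α : Type*) [TopologicalSpace α] :
    Function.Surjective (Ultrafilter.extend (stoneCechUnit : α → StoneCech α)) := by
  refine (continuous_ultrafilter_extend _).surjective_of_denseRange
    (denseRange_stoneCechUnit.mono ?_)
  rintro _ ⟨a, rfl⟩
  exact ⟨pure a, ultrafilter_extend_pure _ a⟩

/-- The Stone–Čech compactification of a space has at most doubly exponential cardinality. -/
theorem mk_stoneCech_le (α : Type*) [TopologicalSpace α] : #(StoneCech α) ≤ (2 : Cardinal) ^ (2 : Cardinal) ^ #α := by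
  refine (mk_le_of_surjective (surjective_ultrafilter_extend_stoneCechUnit α)).trans ?_
  rw [← mk_set, ← mk_set]
  exact mk_le_of_injective (f := fun u : Ultrafilter α => (u : Filter α).sets)
    fun _ _ h => Ultrafilter.coe_injective (Filter.ext fun s => Set.ext_iff.mp h s)

/-- Finitely many subsets of a type are separated by their traces on some finite set. -/
theorem Finset.exists_injOn_filter_mem {α : Type*} (S : Finset (Set α)) :
    ∃ F : Finset α, Set.InjOn (fun A : Set α => (F : Set α) ∩ A) S := by
  classical
  have h (p : Set α × Set α) : ∃ G : Finset α, p.1 ≠ p.2 → (G : Set α) ∩ p.1 ≠ (G : Set α) ∩ p.2 := by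
    by_cases hp : p.1 = p.2
    · exact ⟨∅, fun h => (h hp).elim⟩
    · have hx : ∃ x, ¬ (x ∈ p.1 ↔ x ∈ p.2) := by
        by_contra! hc
        exact hp (Set.ext hc)
      obtain ⟨x, hx⟩ := hx
      exact ⟨{x}, fun _ he => hx (by simpa using Set.ext_iff.mp he x)⟩
  choose G hG using h
  refine ⟨(S ×ˢ S).biUnion G, fun A hA B hB hAB => ?_⟩
  by_contra hne
  refine hG (A, B) hne ?_
  have hsub : (G (A, B) : Set α) ⊆ (S ×ˢ S).biUnion G :=
    Finset.coe_subset.mpr (Finset.subset_biUnion_of_mem G (Finset.mk_mem_product hA hB))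
  rw [← inter_eq_self_of_subset_left hsub, Set.inter_assoc, Set.inter_assoc]
  exact congrArg _ hAB

/-- The family of points of the Cantor cube indexed by the subsets of `α` that witnesses its
density character: the point attached to `(F, 𝒢)` tests whether the trace of a set on `F` belongs
to `𝒢`. -/
noncomputable def cantorCubePoint {α : Type*} (p : Finset α × Finset (Finset α)) (A : Set α) :
    Bool :=
  open Classical in decide (p.1.filter (· ∈ A) ∈ p.2)

theorem denseRange_cantorCubePoint (α : Type*) :
    DenseRange (cantorCubePoint : Finset α × Finset (Finset α) → Set α → Bool) := by
  classical
  intro f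
  rw [mem_closure_iff]
  intro U hU hfU
  obtain ⟨S, u, hu, hSU⟩ := isOpen_pi_iff.mp hU f hfU
  obtain ⟨F, hF⟩ := S.exists_injOn_filter_mem
  refine ⟨_, hSU fun A hA => ?_, mem_range_self
    (F, (S.filter fun A => f A = true).image fun A => F.filter (· ∈ A))⟩
  suffices cantorCubePoint
      (F, (S.filter fun A => f A = true).image fun A => F.filter (· ∈ A)) A = f A by
    rw [this]
    exact (hu A hA).2
  rw [Bool.eq_iff_iff]
  simp only [cantorCubePoint, decide_eq_true_eq, Finset.mem_image, Finset.mem_filter]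
  refine ⟨?_, fun h => ⟨A, ⟨hA, h⟩, rfl⟩⟩
  rintro ⟨B, ⟨hB, hfB⟩, hBA⟩
  have hEq : B = A := hF hB hA (by simpa [Finset.ext_iff, Set.ext_iff] using hBA)
  exact hEq ▸ hfB

/-- The Stone–Čech compactification of an infinite discrete space has at least doubly exponential
cardinality. -/
theorem le_mk_stoneCech (α : Type*) [TopologicalSpace α] [DiscreteTopology α] [Infinite α] :
    (2 : Cardinal) ^ (2 : Cardinal) ^ #α ≤ #(StoneCech α) := by
  have hcard : #α = #(Finset α × Finset (Finset α)) := by simp [mk_finset_of_infinite]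
  obtain ⟨e⟩ := Cardinal.eq.mp hcard
  have hg : Continuous (cantorCubePoint ∘ e : α → Set α → Bool) := continuous_of_discreteTopology
  have hd : DenseRange (stoneCechExtend hg) := by
    refine (denseRange_cantorCubePoint α).mono ?_
    rintro _ ⟨p, rfl⟩
    exact ⟨stoneCechUnit (e.symm p), by simp [stoneCechExtend_stoneCechUnit]⟩
  have hle := mk_le_of_surjective ((continuous_stoneCechExtend hg).surjective_of_denseRange hd)
  simpa using hle

/-- The Stone–Čech compactification `βℕ` of the discrete space of natural numbers has
cardinality `2 ^ 𝔠`, where `𝔠` is the cardinality of the continuum. -/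
theorem card_stoneCech_nat :
    Cardinal.mk (StoneCech ℕ) = 2 ^ Cardinal.continuum := by
  simpa using (mk_stoneCech_le ℕ).antisymm (le_mk_stoneCech ℕ)
end
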